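/- There is at most one admissible family: if (c_λ)_{λ∈Q} and (c′_λ)_{λ∈Q} are both admissible families with values in F = ℚ(q,t), then c_λ = c′_λ for all λ ∈ Q. -/

import Mathlib

open scoped RealInnerProductSpace

attribute [local instance] Classical.propDecidable

noncomputable section

/-- The reflection in the hyperplane orthogonal to `α`. -/
def sref {V : Type*} [NormedAddCommGroup V] [InnerProductSpace ℝ V] (α x : V) : V :=
  x - (2 * ⟪x, α⟫ / ⟪α, α⟫) • α

/-- The coroot `α^∨ = 2α/(α,α)`. -/
def coroot {V : Type*} [NormedAddCommGroup V] [InnerProductSpace ℝ V] (α : V) : V :=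
  (2 / ⟪α, α⟫) • α

/-- The data of a finite reduced irreducible crystallographic root system `R` in a real
inner product space, together with a fixed choice of positive roots and simple roots. -/
structure RSD (V : Type*) [NormedAddCommGroup V] [InnerProductSpace ℝ V] where
  R : Finset V
  Rpos : Finset V
  n : ℕ
  npos : 0 < n
  simple : Fin n → V
  simple_mem : ∀ i, simple i ∈ Rpos
  pos_sub : Rpos ⊆ R
  root_ne_zero : ∀ α ∈ R, α ≠ 0
  pos_or_neg : ∀ α ∈ R, α ∈ Rpos ∨ -α ∈ Rpos
  not_both : ∀ α ∈ Rpos, -α ∉ Rpos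
  pos_combo : ∀ α ∈ Rpos, ∃ c : Fin n → ℕ, α = ∑ i, (c i : ℝ) • simple i
  simple_indep : LinearIndependent ℝ simple
  reduced : ∀ α ∈ R, ∀ c : ℝ, c • α ∈ R → c = 1 ∨ c = -1
  crystal : ∀ α ∈ R, ∀ β ∈ R, ∃ k : ℤ, ⟪β, coroot α⟫ = (k : ℝ)
  refl_mem : ∀ α ∈ R, ∀ β ∈ R, sref α β ∈ R
  spanning : Submodule.span ℝ (R : Set V) = ⊤
  irred : ∀ s : Set V, (∀ α ∈ R, ∀ β ∈ R, α ∈ s → β ∉ s → ⟪α, β⟫ = 0) →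
    (∀ α ∈ R, α ∈ s) ∨ (∀ α ∈ R, α ∉ s)

namespace RSD

variable {V : Type*} [NormedAddCommGroup V] [InnerProductSpace ℝ V]

/-- The map of `V` determined by a word in the simple reflections. -/
def wordMap (S : RSD V) (l : List (Fin S.n)) : V → V :=
  l.foldr (fun i f => sref (S.simple i) ∘ f) id

/-- `w : V → V` is an element of the Weyl group `W`, i.e. a product of simple reflections. -/
def IsWeyl (S : RSD V) (w : V → V) : Prop := ∃ l : List (Fin S.n), w = S.wordMap l

/-- The length `ℓ(w)` of a Weyl group element: the smallest length of a word in the simple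
reflections representing `w`. -/
def len (S : RSD V) (w : V → V) : ℕ :=
  sInf {k | ∃ l : List (Fin S.n), l.length = k ∧ w = S.wordMap l}

/-- `x` and `y` lie in the same Weyl group orbit. -/
def sameOrbit (S : RSD V) (x y : V) : Prop := ∃ w, S.IsWeyl w ∧ w x = y

/-- `x` is dominant: `(x, α_i) ≥ 0` for all simple roots. -/
def Dominant (S : RSD V) (x : V) : Prop := ∀ i, 0 ≤ ⟪x, S.simple i⟫

/-- `w` is a Weyl group element of minimal length among those sending `x` to `y`. -/
def IsMinWord (S : RSD V) (x y : V) (w : V → V) : Prop :=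
  S.IsWeyl w ∧ w x = y ∧ ∀ w' : V → V, S.IsWeyl w' → w' x = y → S.len w ≤ S.len w'

/-- Membership in the root lattice `Q`, the ℤ-span of the simple roots. -/
def inQ (S : RSD V) (x : V) : Prop :=
  ∃ c : Fin S.n → ℤ, x = ∑ i, (c i : ℝ) • S.simple i

/-- The height `ht(λ) = Σ a_i` of an element `λ = Σ a_i α_i` of the root lattice
(the coefficients are unique since the simple roots are linearly independent). -/
def htZ (S : RSD V) (x : V) : ℤ :=
  if h : ∃ c : Fin S.n → ℤ, x = ∑ i, (c i : ℝ) • S.simple i then ∑ i, h.choose i else 0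

/-- The inversion set `Π(w) = {α ∈ R⁺ : w(α) ∈ R⁻}`. -/
def PiSet (S : RSD V) (w : V → V) : Finset V :=
  S.Rpos.filter (fun α => -(w α) ∈ S.Rpos)

/-- `α` is a short root (if all roots have the same length, all roots are short). -/
def IsShort (S : RSD V) (α : V) : Prop :=
  α ∈ S.R ∧ ∀ β ∈ S.R, ⟪α, α⟫ ≤ ⟪β, β⟫

/-- `α` is a long root. -/
def IsLong (S : RSD V) (α : V) : Prop :=
  α ∈ S.R ∧ ∀ β ∈ S.R, ⟪β, β⟫ ≤ ⟪α, α⟫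

/-- The short roots in the inversion set `Π(w)`. -/
def PiS (S : RSD V) (w : V → V) : Finset V :=
  (S.PiSet w).filter (fun α => S.IsShort α)

/-- The long roots in the inversion set `Π(w)`. -/
def PiL (S : RSD V) (w : V → V) : Finset V :=
  (S.PiSet w).filter (fun α => S.IsLong α)

end RSD


/-- The field `F = ℚ(q,t)` of rational functions in two variables over `ℚ`. -/
abbrev FF : Type := FractionRing (MvPolynomial (Fin 2) ℚ)

/-- The variable `q` of `ℚ(q,t)`. -/
def qq : FF := algebraMap (MvPolynomial (Fin 2) ℚ) FF (MvPolynomial.X 0)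

/-- The variable `t` of `ℚ(q,t)`. -/
def tt : FF := algebraMap (MvPolynomial (Fin 2) ℚ) FF (MvPolynomial.X 1)

/-- A family `(c_λ)_{λ∈Q}` of elements of `F = ℚ(q,t)` is admissible if `c_0 = 1` and it
satisfies Cherednik's relations: (i) for every `λ ∈ Q` and simple root `α_i` with
`k = (λ, α_i^∨) > 0`, `t·c_{s_i(λ)} − c_λ = (1−t)·(c_{λ−α_i} + ⋯ + c_{λ−(k−1)α_i})`;
(ii) for every `λ ∈ Q` with `k = (λ, θ^∨) > 0` (`θ` the highest root),
`t·q^k·c_λ − c_{s_θ(λ)} = (1−t)·(q^{k−1}c_{λ−θ} + ⋯ + q·c_{λ−(k−1)θ})`. -/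
def Admissible {V : Type*} [NormedAddCommGroup V] [InnerProductSpace ℝ V]
    (S : RSD V) (θ : V) (c : V → FF) : Prop :=
  c 0 = 1 ∧
  (∀ lam : V, S.inQ lam → ∀ i : Fin S.n, ∀ k : ℕ, 0 < k →
      ⟪lam, coroot (S.simple i)⟫ = (k : ℝ) →
      tt * c (sref (S.simple i) lam) - c lam
        = (1 - tt) * ∑ j ∈ Finset.Ico 1 k, c (lam - (j : ℝ) • S.simple i)) ∧
  (∀ lam : V, S.inQ lam → ∀ k : ℕ, 0 < k → ⟪lam, coroot θ⟫ = (k : ℝ) →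
      tt * qq ^ k * c lam - c (sref θ lam)
        = (1 - tt) * ∑ j ∈ Finset.Ico 1 k, qq ^ (k - j) * c (lam - (j : ℝ) • θ))

section Reflections

variable {V : Type*} [NormedAddCommGroup V] [InnerProductSpace ℝ V]

theorem sref_eq_sub (α x : V) : sref α x = x - ⟪x, coroot α⟫ • α := by
  rw [sref, coroot, real_inner_smul_right]
  congr 2
  ring

theorem inner_coroot_self {α : V} (h : α ≠ 0) : ⟪α, coroot α⟫ = 2 := by
  have h' : ⟪α, α⟫ ≠ 0 := inner_self_ne_zero.mpr h
  rw [coroot, real_inner_smul_right]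
  field_simp

theorem inner_coroot_pos_iff {α : V} (h : α ≠ 0) (x : V) : 0 < ⟪x, coroot α⟫ ↔ 0 < ⟪x, α⟫ := by
  have h' : 0 < ⟪α, α⟫ := real_inner_self_pos.mpr h
  rw [coroot, real_inner_smul_right]
  exact mul_pos_iff_of_pos_left (by positivity)

theorem sref_sref (α x : V) : sref α (sref α x) = x := by
  by_cases h : α = 0
  · simp [sref, h]
  · have h2 := inner_coroot_self h
    rw [sref_eq_sub α (sref α x), sref_eq_sub α x, inner_sub_left, real_inner_smul_left, h2]
    module

theorem inner_sref_sref (α x y : V) : ⟪sref α x, sref α y⟫ = ⟪x, y⟫ := by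
  by_cases h : α = 0
  · simp [sref, h]
  · have h' : ⟪α, α⟫ ≠ 0 := inner_self_ne_zero.mpr h
    simp only [sref, inner_sub_left, inner_sub_right, real_inner_smul_left, real_inner_smul_right,
      real_inner_comm y α]
    rw [real_inner_comm α y]
    field_simp
    ring

theorem inner_sref_coroot (α β x : V) : ⟪sref α x, coroot β⟫ = ⟪x, coroot (sref α β)⟫ := by
  rw [coroot, coroot, inner_sref_sref, real_inner_smul_right, real_inner_smul_right,
    ← inner_sref_sref α (sref α x) β, sref_sref]

theorem inner_sref_coroot_self {α : V} (h : α ≠ 0) (x : V) :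
    ⟪sref α x, coroot α⟫ = -⟪x, coroot α⟫ := by
  rw [sref_eq_sub, inner_sub_left, real_inner_smul_left, inner_coroot_self h]
  ring

end Reflections

namespace RSD

variable {V : Type*} [NormedAddCommGroup V] [InnerProductSpace ℝ V] (S : RSD V)

theorem simple_mem_R (i : Fin S.n) : S.simple i ∈ S.R := S.pos_sub (S.simple_mem i)

theorem simple_ne_zero (i : Fin S.n) : S.simple i ≠ 0 := S.root_ne_zero _ (S.simple_mem_R i)

section Lattice

variable {S}

theorem inQ.sub {x y : V} (hx : S.inQ x) (hy : S.inQ y) : S.inQ (x - y) := by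
  obtain ⟨a, rfl⟩ := hx
  obtain ⟨b, rfl⟩ := hy
  exact ⟨fun i => a i - b i, by simp [sub_smul, Finset.sum_sub_distrib]⟩

theorem inQ.zsmul {x : V} (hx : S.inQ x) (m : ℤ) : S.inQ ((m : ℝ) • x) := by
  obtain ⟨a, rfl⟩ := hx
  exact ⟨fun i => m * a i, by simp [Finset.smul_sum, mul_smul]⟩

theorem inQ_of_mem_R {α : V} (h : α ∈ S.R) : S.inQ α := by
  rcases S.pos_or_neg α h with h | h
  · obtain ⟨c, hc⟩ := S.pos_combo α h
    exact ⟨fun i => c i, by simpa using hc⟩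
  · obtain ⟨c, hc⟩ := S.pos_combo _ h
    refine ⟨fun i => -c i, ?_⟩
    rw [← neg_neg α, hc]
    simp

theorem inQ.exists_int {x α : V} (hx : S.inQ x) (hα : α ∈ S.R) :
    ∃ k : ℤ, ⟪x, coroot α⟫ = k := by
  obtain ⟨a, rfl⟩ := hx
  choose k hk using fun i => S.crystal α hα _ (S.simple_mem_R i)
  exact ⟨∑ i, a i * k i, by simp [sum_inner, real_inner_smul_left, hk]⟩

theorem inQ.exists_nat {x α : V} (hx : S.inQ x) (hα : α ∈ S.R) (h : 0 < ⟪x, α⟫) :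
    ∃ k : ℕ, 0 < k ∧ ⟪x, coroot α⟫ = k := by
  obtain ⟨k, hk⟩ := hx.exists_int hα
  have h' := (inner_coroot_pos_iff (S.root_ne_zero α hα) x).mpr h
  rw [hk, Int.cast_pos] at h'
  lift k to ℕ using h'.le
  exact ⟨k, by exact_mod_cast h', by simpa using hk⟩

theorem inQ.sref {x α : V} (hx : S.inQ x) (hα : α ∈ S.R) : S.inQ (sref α x) := by
  obtain ⟨k, hk⟩ := hx.exists_int hα
  rw [sref_eq_sub, hk]
  exact hx.sub ((inQ_of_mem_R hα).zsmul k)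

end Lattice

/-- The Weyl-invariant quadratic form `x ↦ ∑ (x, β^∨)²`, summed over all roots `β`. -/
def quad (x : V) : ℝ := ∑ β ∈ S.R, ⟪x, coroot β⟫ ^ 2

theorem sq_le_quad {β : V} (hβ : β ∈ S.R) (x : V) : ⟪x, coroot β⟫ ^ 2 ≤ S.quad x :=
  Finset.single_le_sum (f := fun β => ⟪x, coroot β⟫ ^ 2) (fun _ _ => sq_nonneg _) hβ

theorem quad_sref {α : V} (hα : α ∈ S.R) (x : V) : S.quad (sref α x) = S.quad x := by
  refine Finset.sum_nbij' (sref α) (sref α) (fun β hβ => S.refl_mem α hα β hβ)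
    (fun β hβ => S.refl_mem α hα β hβ) (fun β _ => sref_sref α β) (fun β _ => sref_sref α β) ?_
  intro β _
  rw [inner_sref_coroot]

theorem quad_sub_smul (x α : V) (a : ℝ) : S.quad (x - a • α) =
    S.quad x - 2 * a * (∑ β ∈ S.R, ⟪x, coroot β⟫ * ⟪α, coroot β⟫) + a ^ 2 * S.quad α := by
  simp only [quad, Finset.mul_sum, ← Finset.sum_sub_distrib, ← Finset.sum_add_distrib]
  refine Finset.sum_congr rfl fun β _ => ?_
  rw [inner_sub_left, real_inner_smul_left]
  ring

/-- Points strictly between `x` and `s_α x` on an `α`-string have smaller `quad`. -/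
theorem quad_string_le {x α : V} (hα : α ∈ S.R) {k j : ℕ} (hk : ⟪x, coroot α⟫ = k)
    (hj : j ∈ Finset.Ico 1 k) : S.quad (x - (j : ℝ) • α) ≤ S.quad x - 1 := by
  obtain ⟨hj1, hjk⟩ := Finset.mem_Ico.mp hj
  have h4 : 4 ≤ S.quad α := by
    have := S.sq_le_quad hα α
    rw [inner_coroot_self (S.root_ne_zero α hα)] at this
    linarith
  have e := S.quad_sref hα x
  rw [sref_eq_sub, hk, quad_sub_smul] at e
  rw [quad_sub_smul]
  set B := ∑ β ∈ S.R, ⟪x, coroot β⟫ * ⟪α, coroot β⟫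
  have hj1' : (1 : ℝ) ≤ j := by exact_mod_cast hj1
  have hjk' : (j : ℝ) + 1 ≤ k := by exact_mod_cast hjk
  have hB : 2 * B = k * S.quad α := by
    have : (k : ℝ) * (2 * B - k * S.quad α) = 0 := by linarith
    rcases mul_eq_zero.mp this with h | h <;> linarith
  have h1 : 1 ≤ (j : ℝ) * (k - j) := by nlinarith
  have h2 : 2 * (j : ℝ) * B = j * (k * S.quad α) := by rw [← hB]; ring
  rw [h2]
  nlinarith

theorem eq_zero_of_inner_root {x : V} (h : ∀ α ∈ S.R, ⟪x, α⟫ = 0) : x = 0 := by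
  have hx : x ∈ Submodule.span ℝ (S.R : Set V) := S.spanning ▸ Submodule.mem_top
  have : ∀ y ∈ Submodule.span ℝ (S.R : Set V), ⟪x, y⟫ = 0 := by
    intro y hy
    induction hy using Submodule.span_induction with
    | mem y hy => exact h y hy
    | zero => simp
    | add y z _ _ hy hz => rw [inner_add_right, hy, hz, add_zero]
    | smul a y _ hy => rw [real_inner_smul_right, hy, mul_zero]
  exact inner_self_eq_zero.mp (this x hx)

theorem eq_of_inner_coroot {x y : V} (h : ∀ α ∈ S.R, ⟪x, coroot α⟫ = ⟪y, coroot α⟫) : x = y := by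
  refine sub_eq_zero.mp (S.eq_zero_of_inner_root fun α hα => ?_)
  have h' : ⟪α, α⟫ ≠ 0 := inner_self_ne_zero.mpr (S.root_ne_zero α hα)
  have := h α hα
  rw [coroot, real_inner_smul_right, real_inner_smul_right] at this
  rw [inner_sub_left, sub_eq_zero]
  exact mul_left_cancel₀ (by positivity) this

theorem finite_quad_lt (n : ℕ) : {x : V | S.inQ x ∧ S.quad x < n}.Finite := by
  let f : V → S.R → ℤ := fun x α => ⌊⟪x, coroot (α : V)⟫⌋
  have hf : ∀ x, S.inQ x → ∀ α : S.R, (f x α : ℝ) = ⟪x, coroot (α : V)⟫ := by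
    intro x hx α
    obtain ⟨k, hk⟩ := hx.exists_int α.2
    simp [f, hk]
  refine Set.Finite.of_finite_image (f := f)
    ((Set.finite_Icc (fun _ => -(n : ℤ)) (fun _ => (n : ℤ))).subset ?_) ?_
  · rintro _ ⟨x, ⟨hx, hn⟩, rfl⟩
    have hsq : ∀ α, f x α ^ 2 ≤ n := by
      intro α
      have := S.sq_le_quad α.2 x
      rw [← hf x hx] at this
      exact_mod_cast this.trans hn.le
    have habs : ∀ α, |f x α| ≤ n := fun α => by
      rcases eq_or_ne (f x α) 0 with h | h
      · simp [h]
      · have := Int.one_le_abs h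
        nlinarith [hsq α, sq_abs (f x α)]
    exact ⟨fun α => (abs_le.mp (habs α)).1, fun α => (abs_le.mp (habs α)).2⟩
  · rintro x ⟨hx, _⟩ y ⟨hy, _⟩ hxy
    refine S.eq_of_inner_coroot fun α hα => ?_
    rw [← hf x hx ⟨α, hα⟩, ← hf y hy ⟨α, hα⟩, hxy]

section Support

variable {S}

theorem coeff_eq {a b : Fin S.n → ℝ} (h : ∑ i, a i • S.simple i = ∑ i, b i • S.simple i) :
    a = b :=
  funext fun i => Fintype.linearIndependent_iffₛ.mp S.simple_indep a b h i

/-- The coefficients of a root in terms of the simple roots do not have mixed signs. -/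
theorem coeff_nonneg_of_pos {a : Fin S.n → ℝ} (h : ∑ i, a i • S.simple i ∈ S.R) {j : Fin S.n}
    (hj : 0 < a j) (i : Fin S.n) : 0 ≤ a i := by
  rcases S.pos_or_neg _ h with h | h
  · obtain ⟨c, hc⟩ := S.pos_combo _ h
    rw [coeff_eq hc]
    positivity
  · obtain ⟨c, hc⟩ := S.pos_combo _ h
    rw [← Finset.sum_neg_distrib] at hc
    simp only [← neg_smul] at hc
    have := congrFun (coeff_eq hc) j
    have h0 : (0 : ℝ) ≤ c j := by positivity
    linarith

theorem sum_pi_single_smul (i : Fin S.n) (k : ℝ) :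
    ∑ l, (Pi.single i k : Fin S.n → ℝ) l • S.simple l = k • S.simple i := by
  rw [Finset.sum_eq_single i] <;> simp +contextual

theorem sub_smul_simple (a : Fin S.n → ℝ) (i : Fin S.n) (k : ℝ) :
    ∑ l, a l • S.simple l - k • S.simple i
      = ∑ l, (a - Pi.single i k : Fin S.n → ℝ) l • S.simple l := by
  simp only [Pi.sub_apply, sub_smul, Finset.sum_sub_distrib, sum_pi_single_smul]

theorem inner_simple_nonpos {i j : Fin S.n} (hij : i ≠ j) : ⟪S.simple j, S.simple i⟫ ≤ 0 := by
  by_contra! hpos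
  have hk := (inner_coroot_pos_iff (S.simple_ne_zero i) (S.simple j)).mpr hpos
  have hR := S.refl_mem _ (S.simple_mem_R i) _ (S.simple_mem_R j)
  rw [sref_eq_sub, ← one_smul ℝ (S.simple j), ← sum_pi_single_smul, sub_smul_simple,
    sum_pi_single_smul, one_smul] at hR
  have := coeff_nonneg_of_pos hR (j := j) (by simp [hij.symm]) i
  simp [hij] at this
  linarith

/-- If the simple roots split into two orthogonal parts, then every positive root is supported on
one of them. -/
theorem support_of_orthogonal {J : Set (Fin S.n)}
    (hJ : ∀ i ∈ J, ∀ j ∉ J, ⟪S.simple i, S.simple j⟫ = 0) (m : ℕ) (c : Fin S.n → ℕ)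
    (hm : ∑ i, c i = m) (hc : ∑ i, (c i : ℝ) • S.simple i ∈ S.R) :
    (∀ i ∈ J, c i = 0) ∨ (∀ i ∉ J, c i = 0) := by
  induction m using Nat.strong_induction_on generalizing c with
  | _ m ih =>
  set β := ∑ i, (c i : ℝ) • S.simple i with hβ
  obtain ⟨i, hci, hi⟩ : ∃ i, c i ≠ 0 ∧ 0 < ⟪β, S.simple i⟫ := by
    by_contra! h
    have hpos := real_inner_self_pos.mpr (S.root_ne_zero _ hc)
    nth_rw 2 [hβ] at hpos
    rw [inner_sum] at hpos
    refine hpos.not_ge (Finset.sum_nonpos fun i _ => ?_)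
    rw [real_inner_smul_right]
    by_cases h0 : c i = 0
    · simp [h0]
    · exact mul_nonpos_of_nonneg_of_nonpos (by positivity) (h i h0)
  by_cases hother : ∃ j, j ≠ i ∧ c j ≠ 0
  swap
  · push Not at hother
    by_cases hiJ : i ∈ J
    · exact Or.inr fun j hj => hother j (by rintro rfl; exact hj hiJ)
    · exact Or.inl fun j hj => hother j (by rintro rfl; exact hiJ hj)
  obtain ⟨j, hji, hcj⟩ := hother
  obtain ⟨k, hk0, hk⟩ := (inQ_of_mem_R hc).exists_nat (S.simple_mem_R i) hi
  have hR := S.refl_mem _ (S.simple_mem_R i) _ hc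
  rw [sref_eq_sub, hk, hβ, sub_smul_simple] at hR
  have hle := coeff_nonneg_of_pos hR (j := j) (by simp [hji]; omega) i
  simp only [Pi.sub_apply, Pi.single_eq_same, sub_nonneg, Nat.cast_le] at hle
  let c' : Fin S.n → ℕ := c - Pi.single i k
  have hc' : ∀ l, l ≠ i → c' l = c l := fun l hl => by simp [c', hl]
  have hc'i : c' i = c i - k := by simp [c']
  have hcast : ∀ l, (c' l : ℝ) = ((fun l => (c l : ℝ)) - Pi.single i (k : ℝ) : Fin S.n → ℝ) l := by
    intro l
    by_cases hl : l = i
    · subst hl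
      simp [hc'i, Nat.cast_sub hle]
    · simp [hc' l hl, hl]
  have hlt : ∑ l, c' l < m := by
    rw [← hm]
    refine Finset.sum_lt_sum (fun l _ => Nat.sub_le _ _) ⟨i, Finset.mem_univ i, ?_⟩
    omega
  have hR' : ∑ l, (c' l : ℝ) • S.simple l ∈ S.R := by simpa only [hcast] using hR
  have orth : ¬ ∀ l, l ≠ i → c l = 0 ∨ ⟪S.simple l, S.simple i⟫ = 0 := by
    intro h
    have hk2 : ⟪β, coroot (S.simple i)⟫ = c i * 2 := by
      rw [hβ, sum_inner, Finset.sum_eq_single i, real_inner_smul_left,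
        inner_coroot_self (S.simple_ne_zero i)]
      · intro l _ hl
        rw [real_inner_smul_left, coroot, real_inner_smul_right]
        rcases h l hl with h | h <;> simp [h]
      · simp
    rw [hk] at hk2
    have : k = c i * 2 := by exact_mod_cast hk2
    omega
  rcases ih _ hlt c' rfl hR' with h | h
  · refine Or.inl fun l hl => ?_
    have hiJ : i ∉ J := by
      refine fun hiJ => orth fun l hl => ?_
      by_cases hlJ : l ∈ J
      · exact Or.inl (hc' l hl ▸ h l hlJ)
      · exact Or.inr (real_inner_comm (S.simple i) (S.simple l) ▸ hJ i hiJ l hlJ)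
    have hli : l ≠ i := by rintro rfl; exact hiJ hl
    exact hc' l hli ▸ h l hl
  · refine Or.inr fun l hl => ?_
    have hiJ : i ∈ J := by
      by_contra hiJ
      refine orth fun l hl => ?_
      by_cases hlJ : l ∈ J
      · exact Or.inr (hJ l hlJ i hiJ)
      · exact Or.inl (hc' l hl ▸ h l hlJ)
    have hli : l ≠ i := by rintro rfl; exact hl hiJ
    exact hc' l hli ▸ h l hl

/-- If the simple roots split into two orthogonal parts, then one of them is empty. -/
theorem eq_empty_or_univ_of_orthogonal {J : Set (Fin S.n)}
    (hJ : ∀ i ∈ J, ∀ j ∉ J, ⟪S.simple i, S.simple j⟫ = 0) : J = ∅ ∨ J = Set.univ := by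
  let U := Submodule.span ℝ (S.simple '' J)
  let U' := Submodule.span ℝ (S.simple '' Jᶜ)
  have hUU' : U ⟂ U' := by
    refine Submodule.isOrtho_span.mpr ?_
    rintro _ ⟨i, hi, rfl⟩ _ ⟨j, hj, rfl⟩
    exact hJ i hi j hj
  have mem_span : ∀ (K : Set (Fin S.n)) (c : Fin S.n → ℕ), (∀ i ∉ K, c i = 0) →
      ∑ i, (c i : ℝ) • S.simple i ∈ Submodule.span ℝ (S.simple '' K) := by
    intro K c h
    refine Submodule.sum_mem _ fun i _ => ?_
    by_cases hi : i ∈ K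
    · exact Submodule.smul_mem _ _ (Submodule.subset_span ⟨i, hi, rfl⟩)
    · simp [h i hi]
  have hpos : ∀ α ∈ S.Rpos, α ∈ U ∨ α ∈ U' := by
    intro α hα
    obtain ⟨c, rfl⟩ := S.pos_combo α hα
    refine (support_of_orthogonal hJ _ c rfl (S.pos_sub hα)).symm.imp (mem_span J c) fun h => ?_
    exact mem_span Jᶜ c fun i hi => h i (not_not.mp hi)
  have hroot : ∀ α ∈ S.R, α ∈ U ∨ α ∈ U' := by
    intro α hα
    rcases S.pos_or_neg α hα with h | h
    · exact hpos α h
    · simpa using hpos _ h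
  have hsimple : ∀ (K : Set (Fin S.n)) i, S.simple i ∈ Submodule.span ℝ (S.simple '' K) → i ∈ K :=
    fun K i h =>
      by_contra fun hi => S.simple_indep.notMem_span_image hi h
  rcases S.irred U (fun α _ β hβ hαU hβU =>
    Submodule.IsOrtho.inner_eq hUU' hαU ((hroot β hβ).resolve_left hβU)) with h | h
  · exact Or.inr (Set.eq_univ_of_forall fun i => hsimple J i (h _ (S.simple_mem_R i)))
  · exact Or.inl (Set.eq_empty_of_forall_notMem fun i hi =>
      h _ (S.simple_mem_R i) (Submodule.subset_span ⟨i, hi, rfl⟩))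

/-- A dominant root is a combination of the simple roots with positive coefficients. -/
theorem Dominant.exists_pos_coeff {θ : V} (hd : S.Dominant θ) (hθ : θ ∈ S.R) :
    ∃ c : Fin S.n → ℕ, (∀ i, 0 < c i) ∧ θ = ∑ i, (c i : ℝ) • S.simple i := by
  have hpos : θ ∈ S.Rpos := by
    refine (S.pos_or_neg θ hθ).resolve_right fun h => ?_
    obtain ⟨c, hc⟩ := S.pos_combo _ h
    have h0 : 0 ≤ ⟪θ, -θ⟫ := by
      rw [hc, inner_sum]
      refine Finset.sum_nonneg fun i _ => ?_
      rw [real_inner_smul_right]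
      exact mul_nonneg (by positivity) (hd i)
    rw [inner_neg_right] at h0
    linarith [real_inner_self_pos.mpr (S.root_ne_zero θ hθ)]
  obtain ⟨c, hc⟩ := S.pos_combo θ hpos
  refine ⟨c, fun i => Nat.pos_of_ne_zero ?_, hc⟩
  have hJ : ∀ i ∈ {i | c i ≠ 0}, ∀ j ∉ {i | c i ≠ 0}, ⟪S.simple i, S.simple j⟫ = 0 := by
    intro i hi j hj
    simp only [Set.mem_ofPred_eq, not_not] at hi hj
    have hterm : ∀ l ∈ Finset.univ, ⟪(c l : ℝ) • S.simple l, S.simple j⟫ ≤ 0 := by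
      intro l _
      rw [real_inner_smul_left]
      by_cases hl : l = j
      · simp [hl, hj]
      · exact mul_nonpos_of_nonneg_of_nonpos (by positivity) (inner_simple_nonpos (Ne.symm hl))
    have hsum := hd j
    rw [hc, sum_inner] at hsum
    have := (Finset.sum_eq_zero_iff_of_nonpos hterm).mp
      (le_antisymm (Finset.sum_nonpos hterm) hsum) i (Finset.mem_univ i)
    rw [real_inner_smul_left] at this
    exact (mul_eq_zero.mp this).resolve_left (by exact_mod_cast hi)
  rcases eq_empty_or_univ_of_orthogonal hJ with h | h
  · refine absurd ?_ (S.root_ne_zero θ hθ)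
    rw [hc]
    refine Finset.sum_eq_zero fun l _ => ?_
    have : c l = 0 := not_not.mp (Set.eq_empty_iff_forall_notMem.mp h l)
    simp [this]
  · exact Set.eq_univ_iff_forall.mp h i

/-- A nonzero point of the root lattice does not lie in the closed fundamental alcove cone. -/
theorem inQ.exists_inner_simple_neg_or {x θ : V} (hx : S.inQ x) (hx0 : x ≠ 0)
    (hd : S.Dominant θ) (hθ : θ ∈ S.R) : (∃ i, ⟪x, S.simple i⟫ < 0) ∨ 0 < ⟪x, θ⟫ := by
  by_contra! h
  obtain ⟨hdom, hle⟩ := h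
  obtain ⟨c, hcpos, hc⟩ := hd.exists_pos_coeff hθ
  have hterm : ∀ i ∈ Finset.univ, 0 ≤ ⟪x, (c i : ℝ) • S.simple i⟫ := by
    intro i _
    rw [real_inner_smul_right]
    exact mul_nonneg (by positivity) (hdom i)
  rw [hc, inner_sum] at hle
  have hzero : ∀ i, ⟪x, S.simple i⟫ = 0 := by
    intro i
    have := (Finset.sum_eq_zero_iff_of_nonneg hterm).mp
      (le_antisymm hle (Finset.sum_nonneg hterm)) i (Finset.mem_univ i)
    rw [real_inner_smul_right] at this
    exact (mul_eq_zero.mp this).resolve_left (by exact_mod_cast (hcpos i).ne')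
  obtain ⟨a, ha⟩ := hx
  refine hx0 ((inner_self_eq_zero (𝕜 := ℝ)).mp ?_)
  nth_rw 2 [ha]
  rw [inner_sum]
  exact Finset.sum_eq_zero fun i _ => by rw [real_inner_smul_right, hzero, mul_zero]

end Support

end RSD

theorem qq_ne_zero : qq ≠ 0 := by
  simp [qq, MvPolynomial.X_ne_zero]

theorem tt_ne_zero : tt ≠ 0 := by
  simp [tt, MvPolynomial.X_ne_zero]

theorem tt_pow_mul_qq_pow_ne_one {m : ℕ} (hm : m ≠ 0) (e : ℕ) : tt ^ m * qq ^ e ≠ 1 := by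
  intro h
  have h' : (MvPolynomial.X 1 ^ m * MvPolynomial.X 0 ^ e : MvPolynomial (Fin 2) ℚ) = 1 := by
    apply IsFractionRing.injective (MvPolynomial (Fin 2) ℚ) FF
    simpa [tt, qq] using h
  simpa [hm] using congrArg (MvPolynomial.eval (0 : Fin 2 → ℚ)) h'

/-- A function on a finite set which is multiplied by some `t q^e` under a self-map vanishes. -/
theorem eq_zero_of_forall_exists_mul {X : Type*} {s : Set X} (hs : s.Finite) (d : X → FF)
    (h : ∀ x ∈ s, ∃ y ∈ s, ∃ e : ℕ, d y = tt * qq ^ e * d x) : ∀ x ∈ s, d x = 0 := by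
  choose! f hf e he using h
  have hmem : ∀ m : ℕ, ∀ x ∈ s, f^[m] x ∈ s := fun m x hx =>
    Set.MapsTo.iterate (fun x hx => hf x hx) m hx
  have hiter : ∀ m : ℕ, ∀ x ∈ s, ∃ E : ℕ, d (f^[m] x) = tt ^ m * qq ^ E * d x := by
    intro m x hx
    induction m with
    | zero => exact ⟨0, by simp⟩
    | succ m ih =>
      obtain ⟨E, hE⟩ := ih
      refine ⟨E + e (f^[m] x), ?_⟩
      rw [Function.iterate_succ_apply', he _ (hmem m x hx), hE]
      ring
  intro x hx
  obtain ⟨a, b, hab, heq⟩ : ∃ a b : ℕ, a < b ∧ f^[a] x = f^[b] x := by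
    obtain ⟨a, -, b, -, hab, heq⟩ := Set.infinite_univ.exists_lt_map_eq_of_mapsTo
      (f := fun m => f^[m] x) (fun m _ => hmem m x hx) hs
    exact ⟨a, b, hab, heq⟩
  obtain ⟨E, hE⟩ := hiter (b - a) _ (hmem a x hx)
  rw [← Function.iterate_add_apply, Nat.sub_add_cancel hab.le, ← heq] at hE
  obtain ⟨E', hE'⟩ := hiter a x hx
  have hzero : d (f^[a] x) = 0 := by
    by_contra hne
    exact tt_pow_mul_qq_pow_ne_one (Nat.sub_ne_zero_of_lt hab) E
      (mul_right_cancel₀ hne (by rw [one_mul]; exact hE.symm))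
  rw [hzero] at hE'
  exact (mul_eq_zero.mp hE'.symm).resolve_left
    (mul_ne_zero (pow_ne_zero _ tt_ne_zero) (pow_ne_zero _ qq_ne_zero))

/-- There is at most one admissible family: two admissible families with
values in `F = ℚ(q,t)` agree on all of `Q`. -/
theorem admissible_unique
    {V : Type*} [NormedAddCommGroup V] [InnerProductSpace ℝ V]
    (S : RSD V)
    (θ : V) (hθ : θ ∈ S.R ∧ S.Dominant θ ∧ ∀ α ∈ S.R, S.htZ α ≤ S.htZ θ)
    (c c' : V → FF) (hc : Admissible S θ c) (hc' : Admissible S θ c') :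
    ∀ lam : V, S.inQ lam → c lam = c' lam := by
  obtain ⟨h0, hs, ht⟩ := hc
  obtain ⟨h0', hs', ht'⟩ := hc'
  obtain ⟨hθR, hd, -⟩ := hθ
  suffices H : ∀ n : ℕ, ∀ x ∈ {x | S.inQ x ∧ S.quad x < n}, c x - c' x = 0 by
    intro x hx
    obtain ⟨n, hn⟩ := exists_nat_gt (S.quad x)
    exact sub_eq_zero.mp (H n x ⟨hx, hn⟩)
  intro n
  induction n with
  | zero =>
    rintro x ⟨-, hx⟩
    have : 0 ≤ S.quad x := Finset.sum_nonneg fun _ _ => sq_nonneg _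
    norm_num at hx
    linarith
  | succ n ih =>
    have hlow : ∀ x α : V, S.inQ x → S.quad x < (n + 1 : ℕ) → α ∈ S.R → ∀ k : ℕ,
        ⟪x, coroot α⟫ = k → ∀ j ∈ Finset.Ico 1 k, c (x - (j : ℝ) • α) = c' (x - (j : ℝ) • α) := by
      intro x α hx hn hα k hk j hj
      refine sub_eq_zero.mp (ih _ ⟨hx.sub ?_, ?_⟩)
      · exact_mod_cast (RSD.inQ_of_mem_R hα).zsmul j
      · have := S.quad_string_le hα hk hj
        push_cast at hn
        linarith
    refine eq_zero_of_forall_exists_mul (S.finite_quad_lt (n + 1)) (fun x => c x - c' x) ?_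
    rintro x ⟨hx, hn⟩
    by_cases hx0 : x = 0
    · exact ⟨x, ⟨hx, hn⟩, 0, by simp [hx0, h0, h0']⟩
    rcases hx.exists_inner_simple_neg_or hx0 hd hθR with ⟨i, hi⟩ | hpos
    · have hα := S.simple_mem_R i
      have hyQ := hx.sref hα
      have hyn : S.quad (sref (S.simple i) x) < (n + 1 : ℕ) := by rwa [S.quad_sref hα]
      obtain ⟨k, hk0, hk⟩ : ∃ k : ℕ, 0 < k ∧ ⟪sref (S.simple i) x, coroot (S.simple i)⟫ = k := by
        refine hyQ.exists_nat hα ?_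
        have h := S.simple_ne_zero i
        rw [← inner_coroot_pos_iff h, inner_sref_coroot_self h, ← inner_neg_left,
          inner_coroot_pos_iff h, inner_neg_left]
        linarith
      refine ⟨_, ⟨hyQ, hyn⟩, 0, ?_⟩
      have e := hs _ hyQ i k hk0 hk
      have e' := hs' _ hyQ i k hk0 hk
      rw [Finset.sum_congr rfl (hlow _ _ hyQ hyn hα k hk), ← e', sref_sref] at e
      linear_combination -e
    · obtain ⟨k, hk0, hk⟩ := hx.exists_nat hθR hpos
      refine ⟨sref θ x, ⟨hx.sref hθR, by rwa [S.quad_sref hθR]⟩, k, ?_⟩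
      have e := ht x hx k hk0 hk
      have e' := ht' x hx k hk0 hk
      rw [Finset.sum_congr rfl fun j hj => by rw [hlow _ _ hx hn hθR k hk j hj], ← e'] at e
      linear_combination -e

end
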